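/- Let S* = max {S(δ) | δ ∈ P} and suppose δ* ∈ P satisfies S(δ*) = S* and Vol(δ*) ≥ Vol(δ) for every δ ∈ P with S(δ) = S*. Then: (i) there exists π : T → ℝ such that the price conditions hold for (δ*, π); and (ii) for every δ ∈ P for which some π' : T → ℝ satisfies the price conditions for (δ, π'), one has Vol(δ) ≤ Vol(δ*). In other words, an optimal solution of the volume-maximization LP over the surplus-optimal face is feasible for the market model with price conditions and has maximal executed volume among all such feasible solutions. -/

import Mathlib

/-- The **Farkas lemma** for finitely many linear functionals on an arbitrary module. -/
theorem LinearMap.exists_nonneg_sum_smul_of_forall_nonpos {K V J : Type*} [Field K] [LinearOrder K]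
    [IsStrictOrderedRing K] [AddCommGroup V] [Module K V] (s : Finset J) (f : J → V →ₗ[K] K)
    (g : V →ₗ[K] K) (h : ∀ x, (∀ j ∈ s, f j x ≤ 0) → g x ≤ 0) :
    ∃ c : J → K, (∀ j, 0 ≤ c j) ∧ g = ∑ j ∈ s, c j • f j := by
  classical
  induction s using Finset.induction_on generalizing f g with
  | empty =>
    refine ⟨0, fun _ => le_rfl, LinearMap.ext fun x => ?_⟩
    have h₁ := h x (by simp)
    have h₂ := h (-x) (by simp)
    rw [map_neg] at h₂
    simpa using le_antisymm h₁ (by linarith)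
  | insert a s ha ih =>
    by_cases hs : ∀ x, (∀ j ∈ s, f j x ≤ 0) → g x ≤ 0
    · obtain ⟨c, hc, rfl⟩ := ih f g hs
      refine ⟨Function.update c a 0, fun j => ?_, ?_⟩
      · by_cases hj : j = a
        · simp [hj]
        · simpa [hj] using hc j
      · rw [Finset.sum_insert ha]
        simp only [Function.update_self, zero_smul, zero_add]
        refine Finset.sum_congr rfl fun j hj => ?_
        rw [Function.update_of_ne (ne_of_mem_of_not_mem hj ha)]
    · push Not at hs
      obtain ⟨y, hy, hgy⟩ := hs
      have hay : 0 < f a y := by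
        by_contra! hle
        refine absurd (h y fun j hj => ?_) (not_le.2 hgy)
        rcases Finset.mem_insert.1 hj with rfl | hj
        exacts [hle, hy j hj]
      obtain ⟨c, hc, hg⟩ := ih (fun j => f j - (f j y / f a y) • f a)
        (g - (g y / f a y) • f a) fun x hx => by
          have hx' := h (x - (f a x / f a y) • y) fun j hj => by
            rcases Finset.mem_insert.1 hj with rfl | hj
            · simp [hay.ne']
            · convert hx j hj using 1
              simp
              ring
          convert hx' using 1
          simp
          ring
      refine ⟨Function.update c a (g y / f a y - ∑ j ∈ s, c j * (f j y / f a y)),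
        fun j => ?_, ?_⟩
      · by_cases hj : j = a
        · subst hj
          have : ∑ i ∈ s, c i * (f i y / f j y) ≤ 0 := Finset.sum_nonpos fun i hi =>
            mul_nonpos_of_nonneg_of_nonpos (hc i) (div_nonpos_of_nonpos_of_nonneg (hy i hi) hay.le)
          have := div_pos hgy hay
          simp only [Function.update_self]
          linarith
        · simpa [hj] using hc j
      · have hs (k : K) : ∑ j ∈ s, Function.update c a k j • f j = ∑ j ∈ s, c j • f j :=
          Finset.sum_congr rfl fun j hj => by
            rw [Function.update_of_ne (ne_of_mem_of_not_mem hj ha)]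
        rw [Finset.sum_insert ha, Function.update_self, hs]
        ext x
        have hgx := LinearMap.congr_fun hg x
        simp only [LinearMap.sub_apply, LinearMap.add_apply, LinearMap.smul_apply,
          LinearMap.sum_apply, smul_eq_mul, mul_sub, Finset.sum_sub_distrib, sub_mul,
          Finset.sum_mul, mul_assoc] at hgx ⊢
        linarith

/-- If `d` points into the box `[0, b]` at its point `x`, a small positive step along `d` stays in
the box. -/
theorem exists_pos_add_mul_mem_box {I : Type*} [Finite I] {x b d : I → ℝ}
    (hx : ∀ i, 0 ≤ x i ∧ x i ≤ b i) (hd₀ : ∀ i, x i = 0 → 0 ≤ d i)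
    (hd₁ : ∀ i, x i = b i → d i ≤ 0) :
    ∃ ε > 0, ∀ i, 0 ≤ x i + ε * d i ∧ x i + ε * d i ≤ b i := by
  have key : ∀ᶠ ε : ℝ in nhdsWithin 0 (Set.Ioi 0),
      ∀ i, 0 ≤ x i + ε * d i ∧ x i + ε * d i ≤ b i := by
    refine Filter.eventually_all.2 fun i => ?_
    have hlim : Filter.Tendsto (fun ε : ℝ => x i + ε * d i) (nhdsWithin 0 (Set.Ioi 0))
        (nhds (x i)) := by
      have : Continuous fun ε : ℝ => x i + ε * d i := by fun_prop
      simpa using (this.tendsto 0).mono_left nhdsWithin_le_nhds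
    refine Filter.Eventually.and ?_ ?_
    · rcases (hx i).1.eq_or_lt with h | h
      · filter_upwards [self_mem_nhdsWithin] with ε hε
        have := mul_nonneg (le_of_lt hε) (hd₀ i h.symm)
        linarith
      · exact (hlim.eventually_const_lt h).mono fun _ => le_of_lt
    · rcases (hx i).2.eq_or_lt with h | h
      · filter_upwards [self_mem_nhdsWithin] with ε hε
        have := mul_nonpos_of_nonneg_of_nonpos (le_of_lt hε) (hd₁ i h)
        linarith
      · exact (hlim.eventually_lt_const h).mono fun _ => le_of_lt
  obtain ⟨ε, h, hε⟩ := (key.and (self_mem_nhdsWithin (s := Set.Ioi 0))).exists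
  exact ⟨ε, hε, h⟩

/-- Dual multipliers of the equality constraints at a maximizer of a linear functional over a box
intersected with a linear subspace. -/
theorem exists_multipliers_of_isMaxOn_box {I T : Type*} [Fintype I] [Fintype T]
    (q : I → T → ℝ) (c b x : I → ℝ) (hq : ∀ t, ∑ i, q i t * x i = 0)
    (hx : ∀ i, 0 ≤ x i ∧ x i ≤ b i)
    (hmax : ∀ y : I → ℝ, (∀ t, ∑ i, q i t * y i = 0) → (∀ i, 0 ≤ y i ∧ y i ≤ b i) →
      ∑ i, y i * c i ≤ ∑ i, x i * c i) :
    ∃ π : T → ℝ, ∀ i, (0 < x i → 0 ≤ c i - ∑ t, π t * q i t) ∧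
      (x i < b i → c i - ∑ t, π t * q i t ≤ 0) := by
  classical
  let L (v : I → ℝ) : (I → ℝ) →ₗ[ℝ] ℝ := ∑ i, v i • LinearMap.proj i
  have hL (v d : I → ℝ) : L v d = ∑ i, v i * d i := by simp [L]
  let f : (T ⊕ T) ⊕ (I ⊕ I) → (I → ℝ) →ₗ[ℝ] ℝ := Sum.elim
    (Sum.elim (fun t => L fun i => q i t) fun t => -L fun i => q i t)
    (Sum.elim (fun i => (if x i = 0 then -1 else 0 : ℝ) • LinearMap.proj i)
      fun i => (if x i = b i then 1 else 0 : ℝ) • LinearMap.proj i)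
  obtain ⟨m, hm, hg⟩ := LinearMap.exists_nonneg_sum_smul_of_forall_nonpos Finset.univ f (L c)
    fun d hd => by
      have hd₀ (i : I) (hi : x i = 0) : 0 ≤ d i := by
        simpa [f, hi] using hd (.inr (.inl i)) (Finset.mem_univ _)
      have hd₁ (i : I) (hi : x i = b i) : d i ≤ 0 := by
        simpa [f, hi] using hd (.inr (.inr i)) (Finset.mem_univ _)
      have hdq (t : T) : ∑ i, q i t * d i = 0 := by
        have h₁ := hd (.inl (.inl t)) (Finset.mem_univ _)
        have h₂ := hd (.inl (.inr t)) (Finset.mem_univ _)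
        simp only [f, Sum.elim_inl, Sum.elim_inr, LinearMap.neg_apply, hL] at h₁ h₂
        linarith
      obtain ⟨ε, hε, hbox⟩ := exists_pos_add_mul_mem_box hx hd₀ hd₁
      have hle := hmax (fun i => x i + ε * d i) (fun t => by
        simp only [mul_add, mul_left_comm _ ε, Finset.sum_add_distrib, ← Finset.mul_sum, hq, hdq,
          mul_zero, add_zero]) hbox
      simp only [add_mul, mul_assoc, Finset.sum_add_distrib, ← Finset.mul_sum] at hle
      rw [hL, Finset.sum_congr rfl fun i _ => mul_comm (c i) (d i)]
      exact nonpos_of_mul_nonpos_right (by linarith) hε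
  refine ⟨fun t => m (.inl (.inl t)) - m (.inl (.inr t)), fun i => ?_⟩
  have hi : c i - ∑ t, (m (.inl (.inl t)) - m (.inl (.inr t))) * q i t =
      -(if x i = 0 then m (.inr (.inl i)) else 0) + if x i = b i then m (.inr (.inr i)) else 0 := by
    have hgi := LinearMap.congr_fun hg (Pi.single i 1)
    simp [f, hL, LinearMap.sum_apply, Pi.single_apply, -ite_smul] at hgi
    simp only [sub_mul, Finset.sum_sub_distrib]
    rw [hgi]
    split_ifs <;> ring
  rw [hi]
  have h₀ := hm (.inr (.inl i))
  have h₁ := hm (.inr (.inr i))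
  refine ⟨fun h => ?_, fun h => ?_⟩
  · rw [if_neg h.ne']
    split_ifs <;> linarith
  · rw [if_neg h.ne]
    split_ifs <;> linarith

/-- A point of the box satisfying complementary slackness for some multipliers maximizes the linear
functional over the box intersected with the linear subspace. -/
theorem sum_mul_le_sum_mul_of_multipliers {I T : Type*} [Fintype I] [Fintype T]
    {q : I → T → ℝ} {c b x y : I → ℝ} {π : T → ℝ} (hxq : ∀ t, ∑ i, q i t * x i = 0)
    (hyq : ∀ t, ∑ i, q i t * y i = 0)
    (hy : ∀ i, 0 ≤ y i ∧ y i ≤ b i)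
    (hπ : ∀ i, (0 < x i → 0 ≤ c i - ∑ t, π t * q i t) ∧
      (x i < b i → c i - ∑ t, π t * q i t ≤ 0)) :
    ∑ i, y i * c i ≤ ∑ i, x i * c i := by
  have hsum {z : I → ℝ} (hz : ∀ t, ∑ i, q i t * z i = 0) :
      ∑ i, z i * (c i - ∑ t, π t * q i t) = ∑ i, z i * c i := by
    simp only [mul_sub, Finset.sum_sub_distrib, Finset.mul_sum]
    rw [Finset.sum_comm, sub_eq_self]
    refine Finset.sum_eq_zero fun t _ => ?_
    rw [← mul_zero (π t), ← hz t, Finset.mul_sum]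
    exact Finset.sum_congr rfl fun i _ => by ring
  rw [← hsum hxq, ← hsum hyq]
  refine Finset.sum_le_sum fun i _ => ?_
  rcases lt_trichotomy (x i) (y i) with h | h | h
  · exact mul_le_mul_of_nonpos_right h.le ((hπ i).2 (h.trans_le (hy i).2))
  · rw [h]
  · exact mul_le_mul_of_nonneg_right h.le ((hπ i).1 ((hy i).1.trans_lt h))


/-- If `δ*` is feasible, attains the maximal surplus `S*`, and has maximal
volume among feasible points of surplus `S*`, then there exist prices `π` making `(δ*, π)`
satisfy the price conditions, and every feasible `δ` admitting prices satisfying the price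
conditions has volume at most `Vol(δ*)`. -/
theorem volume_max_over_surplus_optimal_face
    {I T : Type*} [Fintype I] [Fintype T]
    (Q p : I → T → ℤ) (δbar : I → ℕ)
    (Sstar : ℝ)
    (hSstar : IsGreatest
      ((fun δ : I → ℝ => ∑ i, δ i * ∑ t, (p i t : ℝ) * (Q i t : ℝ)) ''
        {δ : I → ℝ | (∀ t, ∑ i, (Q i t : ℝ) * δ i = 0) ∧
          ∀ i, 0 ≤ δ i ∧ δ i ≤ (δbar i : ℝ)}) Sstar)
    (δstar : I → ℝ)
    (hclear : ∀ t, ∑ i, (Q i t : ℝ) * δstar i = 0)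
    (hbnd : ∀ i, 0 ≤ δstar i ∧ δstar i ≤ (δbar i : ℝ))
    (hS : ∑ i, δstar i * ∑ t, (p i t : ℝ) * (Q i t : ℝ) = Sstar)
    (hVol : ∀ δ : I → ℝ,
        (∀ t, ∑ i, (Q i t : ℝ) * δ i = 0) →
        (∀ i, 0 ≤ δ i ∧ δ i ≤ (δbar i : ℝ)) →
        ∑ i, δ i * ∑ t, (p i t : ℝ) * (Q i t : ℝ) = Sstar →
        ∑ i, δ i ≤ ∑ i, δstar i) :
    (∃ π : T → ℝ, ∀ i : I,
        (0 < δstar i → 0 ≤ ∑ t, ((p i t : ℝ) - π t) * (Q i t : ℝ)) ∧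
        (δstar i < (δbar i : ℝ) → ∑ t, ((p i t : ℝ) - π t) * (Q i t : ℝ) ≤ 0)) ∧
    (∀ δ : I → ℝ,
        (∀ t, ∑ i, (Q i t : ℝ) * δ i = 0) →
        (∀ i, 0 ≤ δ i ∧ δ i ≤ (δbar i : ℝ)) →
        (∃ π' : T → ℝ, ∀ i : I,
          (0 < δ i → 0 ≤ ∑ t, ((p i t : ℝ) - π' t) * (Q i t : ℝ)) ∧
          (δ i < (δbar i : ℝ) → ∑ t, ((p i t : ℝ) - π' t) * (Q i t : ℝ) ≤ 0)) →
        ∑ i, δ i ≤ ∑ i, δstar i) := by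
  have hgap (π : T → ℝ) (i : I) : ∑ t, ((p i t : ℝ) - π t) * (Q i t : ℝ) =
      ∑ t, (p i t : ℝ) * (Q i t : ℝ) - ∑ t, π t * (Q i t : ℝ) := by
    simp only [sub_mul, Finset.sum_sub_distrib]
  simp only [hgap]
  have hmax (δ : I → ℝ) (hδ : ∀ t, ∑ i, (Q i t : ℝ) * δ i = 0)
      (hδb : ∀ i, 0 ≤ δ i ∧ δ i ≤ (δbar i : ℝ)) :
      ∑ i, δ i * ∑ t, (p i t : ℝ) * (Q i t : ℝ) ≤ Sstar :=
    hSstar.2 ⟨δ, ⟨hδ, hδb⟩, rfl⟩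
  refine ⟨exists_multipliers_of_isMaxOn_box (fun i t => (Q i t : ℝ)) _ _ δstar hclear hbnd
    fun δ hδ hδb => (hmax δ hδ hδb).trans_eq hS.symm, ?_⟩
  rintro δ hδ hδb ⟨π, hπ⟩
  refine hVol δ hδ hδb ((hmax δ hδ hδb).antisymm ?_)
  rw [← hS]
  exact sum_mul_le_sum_mul_of_multipliers (q := fun i t => (Q i t : ℝ)) hδ hclear hbnd hπ
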